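/- Let P be a full-support joint distribution on Ω, fix Y ∈ ι, and for each Π ⊆ ι \ {Y} define the joint distribution Q_Π on Ω by Q_Π(x) = P_{ι\{Y}}(x restricted to ι\{Y}) · P[{Y} | Π](x_Y | x restricted to Π). Then for all Π ⊆ Π' ⊆ ι \ {Y}, D_KL(P ‖ Q_Π) − D_KL(P ‖ Q_{Π'}) = I({Y} ; Π') − I({Y} ; Π) ≥ 0; in particular, enlarging the parent set of the label Y cannot increase the Kullback–Leibler divergence from the original distribution to the fair factorized distribution. -/

import Mathlib

open scoped BigOperators

namespace CausalPre

variable {ι : Type*} [Fintype ι] [DecidableEq ι]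
variable {F : ι → Type*} [∀ i, Fintype (F i)] [∀ i, DecidableEq (F i)]
  [∀ i, Nonempty (F i)]

/-- Restriction of a full configuration to the coordinates in `S`. -/
def restrict (S : Finset ι) (x : ∀ i, F i) : ∀ i : S, F i := fun i => x i

/-- `P` is a joint distribution on `Ω = Π i, F i`. -/
def IsJoint (P : (∀ i, F i) → ℝ) : Prop :=
  (∀ x, 0 ≤ P x) ∧ ∑ x, P x = 1

/-- `P` has full support. -/
def FullSupport (P : (∀ i, F i) → ℝ) : Prop := ∀ x, 0 < P x

/-- Marginal of `P` on the coordinates in `S`. -/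
noncomputable def marginal (P : (∀ i, F i) → ℝ) (S : Finset ι)
    (s : ∀ i : S, F i) : ℝ :=
  ∑ x : ∀ i, F i, if restrict S x = s then P x else 0

/-- Conditional probability `P[T | S]`, evaluated at the restrictions of a full
configuration `x`:  `P[T | S](x_T | x_S) = P_{S ∪ T}(x_{S ∪ T}) / P_S(x_S)`. -/
noncomputable def condProb (P : (∀ i, F i) → ℝ) (T S : Finset ι)
    (x : ∀ i, F i) : ℝ :=
  marginal P (S ∪ T) (restrict (S ∪ T) x) / marginal P S (restrict S x)

/-- Entropy of the marginal of `P` on `S`. -/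
noncomputable def entropy (P : (∀ i, F i) → ℝ) (S : Finset ι) : ℝ :=
  -∑ s : ∀ i : S, F i, marginal P S s * Real.log (marginal P S s)

/-- Mutual information `I(S ; T)` of disjoint `S`, `T`. -/
noncomputable def mutualInfo (P : (∀ i, F i) → ℝ) (S T : Finset ι) : ℝ :=
  entropy P S + entropy P T - entropy P (S ∪ T)

/-- Conditional entropy `H(S | T)` for disjoint `S`, `T`. -/
noncomputable def condEntropy (P : (∀ i, F i) → ℝ) (S T : Finset ι) : ℝ :=
  entropy P (S ∪ T) - entropy P T

/-- Conditional mutual information `I(S ; T | U)` of pairwise disjoint `S`, `T`, `U`. -/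
noncomputable def condMutualInfo (P : (∀ i, F i) → ℝ) (S T U : Finset ι) : ℝ :=
  entropy P (S ∪ U) + entropy P (T ∪ U) - entropy P (S ∪ T ∪ U) - entropy P U

/-- Kullback–Leibler divergence `D_KL(P ‖ Q) = Σ_{x : P(x) > 0} P(x) log (P(x)/Q(x))`. -/
noncomputable def klDiv (P Q : (∀ i, F i) → ℝ) : ℝ :=
  ∑ x, if 0 < P x then P x * Real.log (P x / Q x) else 0

/-- The fair factorized distribution `Q_Π` with label `Y` and parent set `Π`:
`Q_Π(x) = P_{ι \ {Y}}(x_{ι \ {Y}}) · P[{Y} | Π](x_Y | x_Π)`. -/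
noncomputable def fairDist (P : (∀ i, F i) → ℝ) (Y : ι) (Pi : Finset ι)
    (x : ∀ i, F i) : ℝ :=
  marginal P (Finset.univ \ {Y}) (restrict (Finset.univ \ {Y}) x)
    * condProb P {Y} Pi x

section Mass

variable {Ω α β γ : Type*} [Fintype Ω] [DecidableEq α] [DecidableEq β] [DecidableEq γ]

/-- Total `P`-mass of the fibre of `f` over `a`. -/
noncomputable def mass (P : Ω → ℝ) (f : Ω → α) (a : α) : ℝ :=
  ∑ x, if f x = a then P x else 0

theorem sum_mass_mul [Fintype α] (P : Ω → ℝ) (f : Ω → α) (g : α → ℝ) :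
    ∑ a, mass P f a * g a = ∑ x, P x * g (f x) := by
  simp only [mass, Finset.sum_mul, ite_mul, zero_mul]
  rw [Finset.sum_comm]
  simp

theorem mass_apply_congr (P : Ω → ℝ) {f : Ω → α} {g : Ω → β} {z : Ω}
    (h : ∀ x, f x = f z ↔ g x = g z) : mass P f (f z) = mass P g (g z) := by
  simp only [mass, h]

theorem mass_nonneg {P : Ω → ℝ} (hP : ∀ x, 0 ≤ P x) (f : Ω → α) (a : α) :
    0 ≤ mass P f a :=
  Finset.sum_nonneg fun x _ => by split_ifs <;> simp [hP]

theorem mass_apply_pos {P : Ω → ℝ} (hP : ∀ x, 0 < P x) (f : Ω → α) (z : Ω) :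
    0 < mass P f (f z) := by
  refine Finset.sum_pos' (fun x _ => ?_) ⟨z, Finset.mem_univ z, by simp [hP]⟩
  split_ifs <;> simp [(hP x).le]

theorem sum_mass_prodMk [Fintype α] (P : Ω → ℝ) (f : Ω → α) (g : Ω → β) (b : β) :
    ∑ a, mass P (fun x => (f x, g x)) (a, b) = mass P g b := by
  simp only [mass, Prod.mk.injEq, ite_and]
  rw [Finset.sum_comm]
  simp

theorem sum_mass [Fintype α] (P : Ω → ℝ) (f : Ω → α) : ∑ a, mass P f a = ∑ x, P x := by
  simpa using sum_mass_mul P f fun _ => 1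

/-- Conditioning on `B` rather than on a function `φ ∘ B` of it does not increase the entropy
of `A`. -/
theorem sum_mul_log_cond_le [Fintype α] [Fintype β] {P : Ω → ℝ} (hP : ∀ x, 0 < P x)
    (hsum : ∑ x, P x = 1) (A : Ω → α) (B : Ω → β) (φ : β → γ) :
    ∑ x, P x * (Real.log (mass P (fun x => (A x, φ (B x))) (A x, φ (B x)))
        - Real.log (mass P (fun x => φ (B x)) (φ (B x))))
      ≤ ∑ x, P x * (Real.log (mass P (fun x => (A x, B x)) (A x, B x))
        - Real.log (mass P B (B x))) := by
  set pAC := mass P (fun x => (A x, φ (B x)))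
  set pC := mass P (fun x => φ (B x))
  set pAB := mass P (fun x => (A x, B x))
  set pB := mass P B
  have hP0 : ∀ x, 0 ≤ P x := fun x => (hP x).le
  set q : α × β → ℝ := fun p => pAC (p.1, φ p.2) / pC (φ p.2) * pB p.2 with hq
  have hq0 : ∀ p, 0 ≤ q p := fun p =>
    mul_nonneg (div_nonneg (mass_nonneg hP0 _ _) (mass_nonneg hP0 _ _)) (mass_nonneg hP0 _ _)
  have hq1 : ∑ p, q p ≤ 1 := by
    rw [Fintype.sum_prod_type_right, ← hsum, ← sum_mass P B]
    refine Finset.sum_le_sum fun b _ => ?_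
    simp only [hq]
    rw [← Finset.sum_mul, ← Finset.sum_div,
      sum_mass_prodMk P A (fun x => φ (B x)) (φ b)]
    exact mul_le_of_le_one_left (mass_nonneg hP0 _ _) (div_self_le_one _)
  have hratio : ∑ x, P x * (q (A x, B x) / pAB (A x, B x)) ≤ 1 := by
    rw [← sum_mass_mul P (fun x => (A x, B x)) fun p => q p / pAB p]
    refine (Finset.sum_le_sum fun p _ => ?_).trans hq1
    rcases eq_or_ne (pAB p) 0 with h | h
    · simpa [h] using hq0 p
    · exact (mul_div_cancel₀ _ h).le
  rw [← sub_nonpos, ← Finset.sum_sub_distrib]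
  calc _ ≤ ∑ x, (P x * (q (A x, B x) / pAB (A x, B x)) - P x) := by
        refine Finset.sum_le_sum fun x _ => ?_
        have hAC : 0 < pAC (A x, φ (B x)) := mass_apply_pos hP (fun x => (A x, φ (B x))) x
        have hC : 0 < pC (φ (B x)) := mass_apply_pos hP (fun x => φ (B x)) x
        have hABx : 0 < pAB (A x, B x) := mass_apply_pos hP (fun x => (A x, B x)) x
        have hB : 0 < pB (B x) := mass_apply_pos hP B x
        have hpos : 0 < q (A x, B x) / pAB (A x, B x) := by
          simp only [hq]; positivity
        have hlog : Real.log (q (A x, B x) / pAB (A x, B x))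
            = Real.log (pAC (A x, φ (B x))) - Real.log (pC (φ (B x)))
              + Real.log (pB (B x)) - Real.log (pAB (A x, B x)) := by
          simp only [hq]
          rw [Real.log_div (by positivity) (by positivity),
            Real.log_mul (by positivity) (by positivity),
            Real.log_div (by positivity) (by positivity)]
        have h := mul_le_mul_of_nonneg_left (Real.log_le_sub_one_of_pos hpos) (hP0 x)
        rw [hlog] at h
        linarith
    _ ≤ 0 := by
        rw [Finset.sum_sub_distrib, hsum]
        linarith

end Mass

theorem restrict_eq_iff {S : Finset ι} {x z : ∀ i, F i} :
    restrict S x = restrict S z ↔ ∀ i ∈ S, x i = z i := by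
  simp [restrict, funext_iff]

theorem marginal_restrict_pos {P : (∀ i, F i) → ℝ} (hfull : FullSupport P) (S : Finset ι)
    (x : ∀ i, F i) : 0 < marginal P S (restrict S x) :=
  mass_apply_pos hfull (restrict S) x

theorem entropy_eq_neg_sum (P : (∀ i, F i) → ℝ) (S : Finset ι) :
    entropy P S = -∑ x, P x * Real.log (marginal P S (restrict S x)) :=
  congrArg Neg.neg (sum_mass_mul P (restrict S) fun s => Real.log (marginal P S s))

theorem klDiv_fairDist {P : (∀ i, F i) → ℝ} (hfull : FullSupport P) (Y : ι) (S : Finset ι) :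
    klDiv P (fairDist P Y S)
      = ∑ x, P x * Real.log (P x) + entropy P (Finset.univ \ {Y})
        + entropy P (S ∪ {Y}) - entropy P S := by
  simp only [entropy_eq_neg_sum, klDiv, if_pos (hfull _), fairDist, condProb]
  rw [sub_neg_eq_add, ← sub_eq_add_neg, ← sub_eq_add_neg, ← Finset.sum_sub_distrib,
    ← Finset.sum_sub_distrib, ← Finset.sum_add_distrib]
  refine Finset.sum_congr rfl fun x _ => ?_
  have h₀ := (hfull x).ne'
  have h₁ := (marginal_restrict_pos hfull (Finset.univ \ {Y}) x).ne'
  have h₂ := (marginal_restrict_pos hfull (S ∪ {Y}) x).ne'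
  have h₃ := (marginal_restrict_pos hfull S x).ne'
  rw [Real.log_div h₀ (mul_ne_zero h₁ (div_ne_zero h₂ h₃)),
    Real.log_mul h₁ (div_ne_zero h₂ h₃), Real.log_div h₂ h₃]
  ring

/-- Conditional entropy decreases as the conditioning set grows. -/
theorem condEntropy_anti {P : (∀ i, F i) → ℝ} (hP : IsJoint P) (hfull : FullSupport P)
    (Y : ι) {S T : Finset ι} (hST : S ⊆ T) :
    condEntropy P {Y} T ≤ condEntropy P {Y} S := by
  have h := sum_mul_log_cond_le hfull hP.2 (fun x => x Y) (restrict T)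
    (fun t (i : S) => t ⟨i, hST i.2⟩)
  have hpair (U : Finset ι) (z : ∀ i, F i) :
      mass P (fun x => (x Y, restrict U x)) (z Y, restrict U z)
        = marginal P ({Y} ∪ U) (restrict ({Y} ∪ U) z) :=
    mass_apply_congr P (f := fun x => (x Y, restrict U x)) (g := restrict ({Y} ∪ U))
      fun x => by simp [restrict_eq_iff]
  change ∑ x, P x * (Real.log (mass P (fun x => (x Y, restrict S x)) (x Y, restrict S x))
      - Real.log (marginal P S (restrict S x)))
    ≤ ∑ x, P x * (Real.log (mass P (fun x => (x Y, restrict T x)) (x Y, restrict T x))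
      - Real.log (marginal P T (restrict T x))) at h
  simp only [hpair, mul_sub, Finset.sum_sub_distrib] at h
  simp only [condEntropy, entropy_eq_neg_sum]
  linarith

/-- For a full-support joint distribution `P`, a label `Y` and
parent sets `Π ⊆ Π' ⊆ ι \ {Y}`, the KL divergences to the corresponding fair
factorized distributions satisfy
`D_KL(P ‖ Q_Π) − D_KL(P ‖ Q_Π') = I({Y} ; Π') − I({Y} ; Π) ≥ 0`;
enlarging the parent set of `Y` cannot increase the KL divergence. -/
theorem klDiv_fairDist_antitone
    (P : (∀ i, F i) → ℝ) (hP : IsJoint P) (hfull : FullSupport P)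
    (Y : ι) (Pi Pi' : Finset ι)
    (hsub : Pi ⊆ Pi') (hsub' : Pi' ⊆ Finset.univ \ {Y}) :
    klDiv P (fairDist P Y Pi) - klDiv P (fairDist P Y Pi')
        = mutualInfo P {Y} Pi' - mutualInfo P {Y} Pi
      ∧ mutualInfo P {Y} Pi ≤ mutualInfo P {Y} Pi'
      ∧ klDiv P (fairDist P Y Pi') ≤ klDiv P (fairDist P Y Pi) := by
  have hkl : klDiv P (fairDist P Y Pi) - klDiv P (fairDist P Y Pi')
      = mutualInfo P {Y} Pi' - mutualInfo P {Y} Pi := by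
    rw [klDiv_fairDist hfull, klDiv_fairDist hfull, Finset.union_comm Pi,
      Finset.union_comm Pi']
    simp only [mutualInfo]
    ring
  have hmi : mutualInfo P {Y} Pi ≤ mutualInfo P {Y} Pi' := by
    have h := condEntropy_anti hP hfull Y hsub
    simp only [condEntropy] at h
    simp only [mutualInfo]
    linarith
  exact ⟨hkl, hmi, by linarith⟩

end CausalPre
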